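/- arXiv:2002.10604 — 4 statements merged into one kernel-verified Lean document; each statement's English description precedes it below -/
import Mathlib

section
/- A decomposes as the internal direct sum A = B ⊕ x·B of k-vector spaces: every a ∈ A can be written uniquely as a = b + x·b′ with b, b′ ∈ B. -/
section Supercentralizer

variable {k A : Type*} [Field k] [Ring A] [Algebra k A]

/-- The supercentralizer of `x` with respect to the decomposition into `A0` and `A1`. -/
def supercentralizer (A0 A1 : Submodule k A) (x : A) : Submodule k A :=
  (A0 ⊓ LinearMap.ker (LinearMap.mulLeft k x - LinearMap.mulRight k x)) ⊔
    (A1 ⊓ LinearMap.ker (LinearMap.mulLeft k x + LinearMap.mulRight k x))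

theorem mem_supercentralizer {A0 A1 : Submodule k A} {x a : A} :
    a ∈ supercentralizer A0 A1 x ↔
      ∃ b ∈ A0, ∃ c ∈ A1, x * b = b * x ∧ x * c = -(c * x) ∧ b + c = a := by
  simp only [supercentralizer, Submodule.mem_sup, Submodule.mem_inf, LinearMap.mem_ker,
    LinearMap.sub_apply, LinearMap.add_apply, LinearMap.mulLeft_apply, LinearMap.mulRight_apply,
    sub_eq_zero, add_eq_zero_iff_eq_neg]
  grind

theorem eq_zero_of_eq_neg_self (h2 : (2 : k) ≠ 0) {a : A} (h : a = -a) : a = 0 := by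
  have : (2 : k) • a = 0 := by rw [two_smul]; exact add_eq_zero_iff_eq_neg.2 h
  exact (smul_eq_zero.1 this).resolve_left h2

/-- An element commuting with an involution `x` which is `x` times an element anticommuting
with `x` vanishes. -/
theorem eq_zero_of_commute_of_eq_mul (h2 : (2 : k) ≠ 0) {x b c : A} (hxx : x * x = 1)
    (hb : x * b = b * x) (hc : x * c = -(c * x)) (h : b = x * c) : c = 0 := by
  apply eq_zero_of_eq_neg_self h2
  calc c = x * b := by rw [h, ← mul_assoc, hxx, one_mul]
    _ = x * c * x := by rw [hb, h]
    _ = -c := by rw [hc, neg_mul, mul_assoc, hxx, mul_one]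

/-- An element anticommuting with an involution `x` which is `x` times an element commuting
with `x` vanishes. -/
theorem eq_zero_of_anticommute_of_eq_mul (h2 : (2 : k) ≠ 0) {x b c : A} (hxx : x * x = 1)
    (hb : x * b = -(b * x)) (hc : x * c = c * x) (h : b = x * c) : c = 0 := by
  apply eq_zero_of_eq_neg_self h2
  calc c = x * b := by rw [h, ← mul_assoc, hxx, one_mul]
    _ = -(x * c * x) := by rw [hb, h]
    _ = -c := by rw [hc, mul_assoc, hxx, mul_one]

theorem eq_zero_of_mem_supercentralizer_of_eq_mul (h2 : (2 : k) ≠ 0) {A0 A1 : Submodule k A}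
    (hinf : A0 ⊓ A1 = ⊥)
    (h10 : ∀ a ∈ A1, ∀ b ∈ A0, a * b ∈ A1) (h11 : ∀ a ∈ A1, ∀ b ∈ A1, a * b ∈ A0)
    {x : A} (hx1 : x ∈ A1) (hxx : x * x = 1) {b c : A}
    (hb : b ∈ supercentralizer A0 A1 x) (hc : c ∈ supercentralizer A0 A1 x)
    (h : b = x * c) : c = 0 := by
  obtain ⟨b0, hb0, b1, hb1, eb0, eb1, rfl⟩ := mem_supercentralizer.1 hb
  obtain ⟨c0, hc0, c1, hc1, ec0, ec1, rfl⟩ := mem_supercentralizer.1 hc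
  have e : b0 - x * c1 = x * c0 - b1 := by
    rw [sub_eq_sub_iff_add_eq_add, h, mul_add]
  have z : b0 - x * c1 = 0 := by
    rw [← Submodule.mem_bot k, ← hinf]
    refine ⟨sub_mem hb0 (h11 _ hx1 _ hc1), ?_⟩
    rw [e]
    exact sub_mem (h10 _ hx1 _ hc0) hb1
  have z0 : c0 = 0 :=
    eq_zero_of_anticommute_of_eq_mul h2 hxx eb1 ec0 (sub_eq_zero.1 (e ▸ z)).symm
  have z1 : c1 = 0 := eq_zero_of_commute_of_eq_mul h2 hxx eb0 ec1 (sub_eq_zero.1 z)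
  rw [z0, z1, add_zero]

/-- Every element is a sum of one commuting and one anticommuting with the involution `x`. -/
theorem exists_commute_add_anticommute (h2 : (2 : k) ≠ 0) {x : A} (hxx : x * x = 1)
    {S : Submodule k A} (hS : ∀ a ∈ S, x * a * x ∈ S) {a : A} (ha : a ∈ S) :
    ∃ b ∈ S, ∃ c ∈ S, x * b = b * x ∧ x * c = -(c * x) ∧ b + c = a := by
  have l : x * (x * a * x) = a * x := by rw [mul_assoc x a x, ← mul_assoc, hxx, one_mul]
  have r : x * a * x * x = x * a := by rw [mul_assoc, hxx, mul_one]
  refine ⟨(2 : k)⁻¹ • (a + x * a * x), S.smul_mem _ (add_mem ha (hS a ha)),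
    (2 : k)⁻¹ • (a - x * a * x), S.smul_mem _ (sub_mem ha (hS a ha)), ?_, ?_, ?_⟩
  · rw [mul_smul_comm, smul_mul_assoc, mul_add, add_mul, l, r, add_comm]
  · rw [mul_smul_comm, smul_mul_assoc, mul_sub, sub_mul, l, r, ← smul_neg, neg_sub]
  · rw [← smul_add, add_add_sub_cancel, ← two_smul k a, inv_smul_smul₀ h2]

theorem exists_mem_supercentralizer_add_mul (h2 : (2 : k) ≠ 0) {A0 A1 : Submodule k A}
    (hsup : A0 ⊔ A1 = ⊤) (h01 : ∀ a ∈ A0, ∀ b ∈ A1, a * b ∈ A1)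
    (h10 : ∀ a ∈ A1, ∀ b ∈ A0, a * b ∈ A1) (h11 : ∀ a ∈ A1, ∀ b ∈ A1, a * b ∈ A0)
    {x : A} (hx1 : x ∈ A1) (hxx : x * x = 1) (a : A) :
    ∃ b ∈ supercentralizer A0 A1 x, ∃ c ∈ supercentralizer A0 A1 x, a = b + x * c := by
  obtain ⟨a0, ha0, a1, ha1, rfl⟩ := Submodule.mem_sup.1 (hsup ▸ Submodule.mem_top : a ∈ A0 ⊔ A1)
  obtain ⟨b0, hb0, c0, hc0, eb0, ec0, rfl⟩ := exists_commute_add_anticommute h2 hxx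
    (fun a ha => h11 _ (h10 _ hx1 _ ha) _ hx1) ha0
  obtain ⟨b1, hb1, c1, hc1, eb1, ec1, rfl⟩ := exists_commute_add_anticommute h2 hxx
    (fun a ha => h01 _ (h11 _ hx1 _ ha) _ hx1) ha1
  refine ⟨b0 + c1, mem_supercentralizer.2 ⟨b0, hb0, c1, hc1, eb0, ec1, rfl⟩,
    x * b1 + x * c0, mem_supercentralizer.2 ⟨x * b1, h11 _ hx1 _ hb1, x * c0, h10 _ hx1 _ hc0,
      ?_, ?_, rfl⟩, ?_⟩
  · rw [mul_assoc, ← eb1]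
  · rw [mul_assoc, ← mul_neg, ← ec0]
  · rw [mul_add, ← mul_assoc, ← mul_assoc, hxx, one_mul, one_mul]
    abel

end Supercentralizer

/-- `A` decomposes as the internal direct sum `A = B ⊕ x·B` of `k`-vector spaces:
every `a ∈ A` can be written uniquely as `a = b + x·b′` with `b, b′ ∈ B`, where `B` is the
supercentralizer of the odd square-one element `x`. -/
theorem decomposition_supercentralizer
    (k A : Type*) [Field k] [Ring A] [Algebra k A]
    (h2 : (2 : k) ≠ 0)
    (A0 A1 : Submodule k A)
    (hsup : A0 ⊔ A1 = ⊤) (hinf : A0 ⊓ A1 = ⊥)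
    (h00 : ∀ a ∈ A0, ∀ b ∈ A0, a * b ∈ A0)
    (h01 : ∀ a ∈ A0, ∀ b ∈ A1, a * b ∈ A1)
    (h10 : ∀ a ∈ A1, ∀ b ∈ A0, a * b ∈ A1)
    (h11 : ∀ a ∈ A1, ∀ b ∈ A1, a * b ∈ A0)
    (hone : (1 : A) ∈ A0)
    (x : A) (hx1 : x ∈ A1) (hxx : x * x = 1)
    (B : Submodule k A)
    (hB : B = (A0 ⊓ LinearMap.ker (LinearMap.mulLeft k x - LinearMap.mulRight k x)) ⊔
        (A1 ⊓ LinearMap.ker (LinearMap.mulLeft k x + LinearMap.mulRight k x))) :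
    ∀ a : A, ∃! p : B × B, a = (p.1 : A) + x * (p.2 : A) := by
  intro a
  change B = supercentralizer A0 A1 x at hB
  subst hB
  obtain ⟨b, hb, c, hc, rfl⟩ :=
    exists_mem_supercentralizer_add_mul h2 hsup h01 h10 h11 hx1 hxx a
  refine ⟨(⟨b, hb⟩, ⟨c, hc⟩), rfl, ?_⟩
  rintro ⟨⟨b', hb'⟩, ⟨c', hc'⟩⟩ h
  have e : b - b' = x * (c' - c) := by
    rw [mul_sub, sub_eq_sub_iff_add_eq_add, add_comm (x * c')]
    exact h
  have z : c' - c = 0 := eq_zero_of_mem_supercentralizer_of_eq_mul h2 hinf h10 h11 hx1 hxx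
    (sub_mem hb hb') (sub_mem hc' hc) e
  rw [z, mul_zero] at e
  simp only [Prod.mk.injEq, Subtype.mk.injEq]
  exact ⟨(sub_eq_zero.1 e).symm, sub_eq_zero.1 z⟩
end

section
/- The algebra A is isomorphic, as a k-algebra, to the graded (super) tensor product Cl(q) ⊗̂ B, where Cl(q) is the Clifford algebra of the quadratic form q(t) = t² on the one-dimensional k-vector space k with its standard ℤ/2-grading; the isomorphism Cl(q) ⊗̂ B → A sends the generator of the one-dimensional space to x and restricts to the inclusion on B. -/
open scoped TensorProduct

namespace CliffordAlgebra

variable {k : Type*} [Field k]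

/-- Even elements of the Clifford algebra of `t ↦ t²` are scalars. -/
theorem exists_algebraMap_of_mem_evenOdd_zero_sq
    {c : CliffordAlgebra (QuadraticMap.sq (R := k) (A := k))} (hc : c ∈ evenOdd _ 0) :
    ∃ r : k, c = algebraMap k _ r := by
  induction c, hc using even_induction with
  | algebraMap r => exact ⟨r, rfl⟩
  | add a b _ _ ha hb =>
    obtain ⟨r, rfl⟩ := ha
    obtain ⟨s, rfl⟩ := hb
    exact ⟨r + s, (map_add _ _ _).symm⟩
  | ι_mul_ι_mul m n a _ ha =>
    obtain ⟨r, rfl⟩ := ha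
    refine ⟨m * n * r, ?_⟩
    have hm : ι (QuadraticMap.sq (R := k) (A := k)) m = m • ι _ 1 := by
      rw [← map_smul, smul_eq_mul, mul_one]
    have hn : ι (QuadraticMap.sq (R := k) (A := k)) n = n • ι _ 1 := by
      rw [← map_smul, smul_eq_mul, mul_one]
    have hmn : ι (QuadraticMap.sq (R := k) (A := k)) m * ι _ n = algebraMap k _ (m * n) := by
      rw [hm, hn, smul_mul_assoc, mul_smul_comm, ι_sq_scalar, smul_smul, Algebra.smul_def,
        ← map_mul, QuadraticMap.sq_apply, mul_one, mul_one]
    rw [hmn, ← map_mul]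

/-- Odd elements of the Clifford algebra of `t ↦ t²` are multiples of the generator. -/
theorem exists_smul_ι_of_mem_evenOdd_one_sq
    {c : CliffordAlgebra (QuadraticMap.sq (R := k) (A := k))} (hc : c ∈ evenOdd _ 1) :
    ∃ r : k, c = r • ι _ 1 := by
  have hsq : ι (QuadraticMap.sq (R := k) (A := k)) 1 * ι _ 1 = 1 := by
    rw [ι_sq_scalar]
    simp
  have hmem : c * ι (QuadraticMap.sq (R := k) (A := k)) 1 ∈ evenOdd _ 0 := by
    have h : (1 + 1 : ZMod 2) = 0 := by decide
    exact h ▸ evenOdd_mul_le _ 1 1 (Submodule.mul_mem_mul hc (ι_mem_evenOdd_one _ 1))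
  obtain ⟨r, hr⟩ := exists_algebraMap_of_mem_evenOdd_zero_sq hmem
  refine ⟨r, ?_⟩
  rw [Algebra.smul_def, ← hr, mul_assoc, hsq, mul_one]

/-- Every element of the Clifford algebra of `t ↦ t²` is a combination of `1` and the
generator. -/
theorem exists_eq_algebraMap_add_smul_ι_sq
    (c : CliffordAlgebra (QuadraticMap.sq (R := k) (A := k))) :
    ∃ r s : k, c = algebraMap k _ r + s • ι _ 1 := by
  have hc : c ∈ evenOdd (QuadraticMap.sq (R := k) (A := k)) 0 ⊔ evenOdd _ 1 := by
    rw [(evenOdd_isCompl _).sup_eq_top]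
    trivial
  obtain ⟨a, ha, b, hb, rfl⟩ := Submodule.mem_sup.mp hc
  obtain ⟨r, rfl⟩ := exists_algebraMap_of_mem_evenOdd_zero_sq ha
  obtain ⟨s, rfl⟩ := exists_smul_ι_of_mem_evenOdd_one_sq hb
  exact ⟨r, s, rfl⟩

/-- Every element of `Cl(t²) ⊗̂ B` has the form `1 ⊗ b + ι 1 ⊗ c`. -/
theorem exists_eq_one_tmul_add_ι_tmul {B : Type*} [Ring B] [Algebra k B]
    (ℬ : ZMod 2 → Submodule k B) [GradedAlgebra ℬ]
    (t : evenOdd (QuadraticMap.sq (R := k) (A := k)) ᵍ⊗[k] ℬ) :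
    ∃ b c : B, t = (1 : CliffordAlgebra (QuadraticMap.sq (R := k) (A := k))) ᵍ⊗ₜ[k] b +
      (ι (QuadraticMap.sq (R := k) (A := k)) 1) ᵍ⊗ₜ[k] c := by
  obtain ⟨t, rfl⟩ := (GradedTensorProduct.of k _ ℬ).surjective t
  suffices h : ∃ b c : B, t = (1 : CliffordAlgebra (QuadraticMap.sq (R := k) (A := k))) ⊗ₜ[k] b +
      (ι (QuadraticMap.sq (R := k) (A := k)) 1) ⊗ₜ[k] c by
    obtain ⟨b, c, rfl⟩ := h
    exact ⟨b, c, map_add _ _ _⟩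
  induction t with
  | zero => exact ⟨0, 0, by simp⟩
  | tmul a b =>
    obtain ⟨r, s, rfl⟩ := exists_eq_algebraMap_add_smul_ι_sq a
    refine ⟨r • b, s • b, ?_⟩
    rw [TensorProduct.add_tmul, Algebra.algebraMap_eq_smul_one, TensorProduct.smul_tmul,
      TensorProduct.smul_tmul]
  | add t u ht hu =>
    obtain ⟨b, c, rfl⟩ := ht
    obtain ⟨b', c', rfl⟩ := hu
    refine ⟨b + b', c + c', ?_⟩
    rw [TensorProduct.tmul_add, TensorProduct.tmul_add]
    abel

end CliffordAlgebra

/-- `A` is isomorphic, as a `k`-algebra, to the graded (super) tensor product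
`Cl(q) ⊗̂ B`, where `Cl(q)` is the Clifford algebra of the quadratic form `q(t) = t²` on the
one-dimensional `k`-vector space `k` with its standard `ℤ/2`-grading, and `B` is the
supercentralizer of the odd square-one element `x`, with its grading induced from that of `A`.
The isomorphism sends the generator of the one-dimensional space to `x` and restricts to the
inclusion on `B`. -/
theorem iso_clifford_graded_tensor_supercentralizer
    (k A : Type*) [Field k] [Ring A] [Algebra k A]
    (h2 : (2 : k) ≠ 0)
    (A0 A1 : Submodule k A)
    (hsup : A0 ⊔ A1 = ⊤) (hinf : A0 ⊓ A1 = ⊥)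
    (h00 : ∀ a ∈ A0, ∀ b ∈ A0, a * b ∈ A0)
    (h01 : ∀ a ∈ A0, ∀ b ∈ A1, a * b ∈ A1)
    (h10 : ∀ a ∈ A1, ∀ b ∈ A0, a * b ∈ A1)
    (h11 : ∀ a ∈ A1, ∀ b ∈ A1, a * b ∈ A0)
    (hone : (1 : A) ∈ A0)
    (x : A) (hx1 : x ∈ A1) (hxx : x * x = 1)
    (B : Subalgebra k A)
    (hB : Subalgebra.toSubmodule B =
        (A0 ⊓ LinearMap.ker (LinearMap.mulLeft k x - LinearMap.mulRight k x)) ⊔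
        (A1 ⊓ LinearMap.ker (LinearMap.mulLeft k x + LinearMap.mulRight k x)))
    -- the `ℤ/2`-grading on `B` induced by that of `A`
    (ℬ : ZMod 2 → Submodule k B) [GradedAlgebra ℬ]
    (hℬ0 : ∀ b : B, b ∈ ℬ 0 ↔ (b : A) ∈ A0)
    (hℬ1 : ∀ b : B, b ∈ ℬ 1 ↔ (b : A) ∈ A1) :
    ∃ φ : (CliffordAlgebra.evenOdd (QuadraticMap.sq (R := k) (A := k)) ᵍ⊗[k] ℬ) ≃ₐ[k] A,
      (∀ b : B, φ ((1 : CliffordAlgebra (QuadraticMap.sq (R := k) (A := k))) ᵍ⊗ₜ[k] b) = b) ∧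
      φ ((CliffordAlgebra.ι (QuadraticMap.sq (R := k) (A := k)) (1 : k)) ᵍ⊗ₜ[k] (1 : B)) = x := by
  have memB0 {a : A} (ha : a ∈ A0) (h : x * a = a * x) : a ∈ B := by
    rw [← Subalgebra.mem_toSubmodule, hB]
    exact Submodule.mem_sup_left ⟨ha, by simp [h]⟩
  have memB1 {a : A} (ha : a ∈ A1) (h : x * a = -(a * x)) : a ∈ B := by
    rw [← Subalgebra.mem_toSubmodule, hB]
    exact Submodule.mem_sup_right ⟨ha, by simp [h]⟩
  have disj {a b : A} (ha : a ∈ A0) (hb : b ∈ A1) (h : a + b = 0) : a = 0 ∧ b = 0 := by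
    have hmem : a ∈ A0 ⊓ A1 := ⟨ha, by
      rw [eq_neg_of_add_eq_zero_left h]
      exact A1.neg_mem hb⟩
    rw [hinf, Submodule.mem_bot] at hmem
    exact ⟨hmem, by simpa [hmem] using h⟩
  have decB {b : A} (hb : b ∈ B) : ∃ b0 ∈ A0, ∃ b1 ∈ A1,
      x * b0 = b0 * x ∧ x * b1 = -(b1 * x) ∧ b = b0 + b1 := by
    rw [← Subalgebra.mem_toSubmodule, hB] at hb
    obtain ⟨b0, ⟨h0, h0'⟩, b1, ⟨h1, h1'⟩, rfl⟩ := Submodule.mem_sup.mp hb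
    refine ⟨b0, h0, b1, h1, ?_, ?_, rfl⟩
    · simpa [sub_eq_zero] using h0'
    · simpa [add_eq_zero_iff_eq_neg] using h1'
  have comm0 {b : A} (hb : b ∈ B) (h : b ∈ A0) : x * b = b * x := by
    obtain ⟨b0, h0, b1, h1, e0, -, rfl⟩ := decB hb
    have h1' : b1 ∈ A0 := by simpa using A0.sub_mem h h0
    obtain ⟨-, rfl⟩ := disj (A0.neg_mem h1') h1 (neg_add_cancel b1)
    simpa using e0
  have comm1 {b : A} (hb : b ∈ B) (h : b ∈ A1) : x * b = -(b * x) := by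
    obtain ⟨b0, h0, b1, h1, -, e1, rfl⟩ := decB hb
    have h0' : b0 ∈ A1 := by simpa using A1.sub_mem h h1
    obtain ⟨rfl, -⟩ := disj h0 (A1.neg_mem h0') (add_neg_cancel b0)
    simpa using e1
  have half {a : A} (h : a + a = 0) : a = 0 := by
    rw [← two_smul k] at h
    exact (smul_eq_zero.mp h).resolve_left h2
  have xx (a : A) : x * (x * a) = a := by rw [← mul_assoc, hxx, one_mul]
  have indep {b c : A} (hb : b ∈ B) (hc : c ∈ B) (h : b + x * c = 0) : b = 0 ∧ c = 0 := by
    have cancel {u v : A} (hu : x * u = u * x) (hv : x * v = -(v * x)) (huv : u + x * v = 0) :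
        u = 0 ∧ v = 0 := by
      have hv0 : v = 0 := by
        apply half
        have h1 : x * u + v = 0 := by simpa [mul_add, xx] using congrArg (x * ·) huv
        have h2 : u * x - v = 0 := by
          have := congrArg (· * x) huv
          simpa [add_mul, hv, mul_assoc, hxx, sub_eq_add_neg] using this
        rw [← hu] at h2
        calc v + v = (x * u + v) - (x * u - v) := by abel
          _ = 0 := by rw [h1, h2, sub_zero]
      subst hv0
      exact ⟨by simpa using huv, rfl⟩
    have cancel' {u v : A} (hu : x * u = -(u * x)) (hv : x * v = v * x) (huv : u + x * v = 0) :
        u = 0 ∧ v = 0 :=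
      (cancel hv hu (by simpa [mul_add, xx, add_comm] using congrArg (x * ·) huv)).symm
    obtain ⟨b0, hb0, b1, hb1, eb0, eb1, rfl⟩ := decB hb
    obtain ⟨c0, hc0, c1, hc1, ec0, ec1, rfl⟩ := decB hc
    obtain ⟨h0, h1⟩ := disj (A0.add_mem hb0 (h11 x hx1 c1 hc1))
      (A1.add_mem hb1 (h10 x hx1 c0 hc0)) (by rw [← h, mul_add]; abel)
    obtain ⟨rfl, rfl⟩ := cancel eb0 ec1 h0
    obtain ⟨rfl, rfl⟩ := cancel' eb1 ec0 h1
    simp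
  let f : CliffordAlgebra (QuadraticMap.sq (R := k) (A := k)) →ₐ[k] A :=
    CliffordAlgebra.lift _ ⟨LinearMap.toSpanSingleton k A x, fun m => by
      simp [hxx, Algebra.algebraMap_eq_smul_one, smul_smul]⟩
  have hf : f (CliffordAlgebra.ι _ 1) = x := by simp [f]
  have hcomm : ∀ ⦃i j : ZMod 2⦄ (a : CliffordAlgebra.evenOdd (QuadraticMap.sq (R := k) (A := k)) i)
      (b : ℬ j), f a * B.val b = (-1 : ℤˣ) ^ (j * i) • (B.val b * f a) := by
    have zero_or_one : ∀ i : ZMod 2, i = 0 ∨ i = 1 := by decide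
    rintro i j ⟨a, ha⟩ ⟨b, hb⟩
    obtain rfl | rfl := zero_or_one i
    · obtain ⟨r, rfl⟩ := CliffordAlgebra.exists_algebraMap_of_mem_evenOdd_zero_sq ha
      simpa using Algebra.commutes r (b : A)
    · obtain ⟨r, rfl⟩ := CliffordAlgebra.exists_smul_ι_of_mem_evenOdd_one_sq ha
      obtain rfl | rfl := zero_or_one j
      · simp [hf, comm0 b.2 ((hℬ0 b).mp hb)]
      · simp [hf, comm1 b.2 ((hℬ1 b).mp hb)]
  let φ := GradedTensorProduct.lift _ ℬ f B.val hcomm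
  have φ_one (b : B) : φ (1 ᵍ⊗ₜ[k] b) = b := by simp [φ]
  have φ_ι (b : B) : φ ((CliffordAlgebra.ι _ 1) ᵍ⊗ₜ[k] b) = x * b := by simp [φ, hf]
  have inj : Function.Injective φ := by
    rw [injective_iff_map_eq_zero]
    intro t ht
    obtain ⟨b, c, rfl⟩ := CliffordAlgebra.exists_eq_one_tmul_add_ι_tmul ℬ t
    rw [map_add, φ_one, φ_ι] at ht
    obtain ⟨hb, hc⟩ := indep b.2 c.2 ht
    rw [Subtype.ext (a2 := (0 : B)) hb, Subtype.ext (a2 := (0 : B)) hc]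
    simp [GradedTensorProduct.tmul]
  have x_mem : x ∈ φ.range := ⟨_, by simpa using φ_ι 1⟩
  have B_le {b : A} (hb : b ∈ B) : b ∈ φ.range := ⟨_, φ_one ⟨b, hb⟩⟩
  have of_double {a : A} (h : a + a ∈ φ.range) : a ∈ φ.range := by
    have := φ.range.smul_mem h (2⁻¹ : k)
    rwa [← two_smul k, smul_smul, inv_mul_cancel₀ h2, one_smul] at this
  have surj : Function.Surjective φ := by
    intro a
    change a ∈ φ.range
    obtain ⟨a0, h0, a1, h1, rfl⟩ := Submodule.mem_sup.mp (hsup ▸ Submodule.mem_top : a ∈ A0 ⊔ A1)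
    have conj_mul (a : A) : x * a * x * x = x * a := by rw [mul_assoc, hxx, mul_one]
    refine add_mem (of_double ?_) (of_double ?_)
    · have e : a0 + a0 = (a0 + x * a0 * x) + x * (x * a0 - a0 * x) := by
        rw [mul_sub, xx, ← mul_assoc]
        abel
      rw [e]
      refine add_mem (B_le (memB0 ?_ ?_)) (mul_mem x_mem (B_le (memB1 ?_ ?_)))
      · exact A0.add_mem h0 (h11 _ (h10 _ hx1 _ h0) _ hx1)
      · rw [mul_add, add_mul, conj_mul, mul_assoc, xx, add_comm]
      · exact A1.sub_mem (h10 _ hx1 _ h0) (h01 _ h0 _ hx1)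
      · rw [mul_sub, sub_mul, xx, mul_assoc a0, hxx, mul_one, neg_sub, ← mul_assoc]
    · have e : a1 + a1 = (a1 - x * a1 * x) + x * (x * a1 + a1 * x) := by
        rw [mul_add, xx, ← mul_assoc]
        abel
      rw [e]
      refine add_mem (B_le (memB1 ?_ ?_)) (mul_mem x_mem (B_le (memB0 ?_ ?_)))
      · exact A1.sub_mem h1 (h01 _ (h11 _ hx1 _ h1) _ hx1)
      · rw [mul_sub, sub_mul, conj_mul, mul_assoc, xx, neg_sub]
      · exact A0.add_mem (h11 _ hx1 _ h1) (h11 _ h1 _ hx1)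
      · rw [mul_add, add_mul, xx, mul_assoc a1, hxx, mul_one, ← mul_assoc, add_comm]
  exact ⟨AlgEquiv.ofBijective φ ⟨inj, surj⟩, φ_one, (φ_ι 1).trans (mul_one x)⟩
end

section
/- Every graded two-sided ideal I of A decomposes as I = (I ∩ B) ⊕ x·(I ∩ B): every element of I can be written uniquely as b + x·b′ with b, b′ ∈ I ∩ B. Moreover I ∩ B is a graded two-sided ideal of the subalgebra B. -/
/-- If `x² = 1` and `2` is invertible, every `a ∈ I` is `p + x q` with `p, q ∈ I`, where `p`
commutes and `q` anticommutes with `x`; both are explicit combinations of `a`, `x a`, `a x` and `x a x`. -/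
theorem exists_commute_add_mul_anticommute {k A : Type*} [Field k] [Ring A] [Algebra k A]
    (h2 : (2 : k) ≠ 0) {x : A} (hxx : x * x = 1) (I : TwoSidedIdeal A) {a : A} (ha : a ∈ I) :
    ∃ p ∈ I, ∃ q ∈ I, p = (2⁻¹ : k) • (a + x * a * x) ∧ q = (2⁻¹ : k) • (x * a - a * x) ∧
      x * p = p * x ∧ x * q = -(q * x) ∧ a = p + x * q := by
  have smul_mem (c : k) {b : A} (hb : b ∈ I) : c • b ∈ I := by
    rw [Algebra.smul_def]
    exact I.mul_mem_left _ _ hb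
  have hl (b : A) : x * (x * b) = b := by rw [← mul_assoc, hxx, one_mul]
  refine ⟨_, smul_mem _ (I.add_mem ha (I.mul_mem_right _ _ (I.mul_mem_left _ _ ha))),
    _, smul_mem _ (I.sub_mem (I.mul_mem_left x _ ha) (I.mul_mem_right _ x ha)), rfl, rfl, ?_, ?_, ?_⟩
  · simp only [mul_smul_comm, smul_mul_assoc, mul_add, add_mul, mul_assoc, hl, hxx, mul_one]
    rw [add_comm]
  · simp only [mul_smul_comm, smul_mul_assoc, mul_sub, sub_mul, mul_assoc, hl, hxx, mul_one]
    rw [← smul_neg, neg_sub]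
  · simp only [mul_smul_comm, mul_sub, mul_assoc, hl]
    rw [← smul_add, add_add_sub_cancel, ← two_smul k a, smul_smul, inv_mul_cancel₀ h2, one_smul]

/-- If `x² = 1`, `x` commutes with `b` and anticommutes with `c`, then `b + x c = 0` forces
`b = c = 0` in characteristic different from two. -/
theorem eq_zero_of_commute_add_mul_anticommute {k A : Type*} [Field k] [Ring A] [Algebra k A]
    (h2 : (2 : k) ≠ 0) {x b c : A} (hxx : x * x = 1) (hb : x * b = b * x) (hc : x * c = -(c * x))
    (h : b + x * c = 0) : b = 0 ∧ c = 0 := by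
  have hb' : b = -(x * c) := eq_neg_of_add_eq_zero_left h
  have hl : x * (x * c) = c := by rw [← mul_assoc, hxx, one_mul]
  have hr : x * c * x = -c := by rw [hc, neg_mul, mul_assoc, hxx, mul_one]
  rw [hb', mul_neg, neg_mul, hl, hr, neg_neg, neg_eq_iff_add_eq_zero, ← two_smul k c] at hb
  have hc0 : c = 0 := (smul_eq_zero.mp hb).resolve_left h2
  exact ⟨by rw [hb', hc0, mul_zero, neg_zero], hc0⟩

/-- Variant of `eq_zero_of_commute_add_mul_anticommute` where `x` anticommutes with `b` and commutes
with `c`. -/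
theorem eq_zero_of_anticommute_add_mul_commute {k A : Type*} [Field k] [Ring A] [Algebra k A]
    (h2 : (2 : k) ≠ 0) {x b c : A} (hxx : x * x = 1) (hb : x * b = -(b * x)) (hc : x * c = c * x)
    (h : b + x * c = 0) : b = 0 ∧ c = 0 := by
  refine (eq_zero_of_commute_add_mul_anticommute h2 hxx hc hb ?_).symm
  rw [← one_mul c, ← hxx, mul_assoc, ← mul_add, add_comm, h, mul_zero]

/-- Homogeneous components are unique. -/
theorem Submodule.eq_and_eq_of_add_eq_add {k A : Type*} [Ring k] [AddCommGroup A] [Module k A]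
    {A0 A1 : Submodule k A} (hinf : A0 ⊓ A1 = ⊥) {a0 b0 a1 b1 : A} (ha0 : a0 ∈ A0) (hb0 : b0 ∈ A0)
    (ha1 : a1 ∈ A1) (hb1 : b1 ∈ A1) (h : a0 + a1 = b0 + b1) : a0 = b0 ∧ a1 = b1 := by
  have h' : a0 - b0 = b1 - a1 := by
    rw [sub_eq_sub_iff_add_eq_add, h, add_comm]
  have h0 : a0 - b0 = 0 := by
    rw [← Submodule.mem_bot k, ← hinf]
    exact ⟨A0.sub_mem ha0 hb0, h' ▸ A1.sub_mem hb1 ha1⟩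
  exact ⟨sub_eq_zero.mp h0, (sub_eq_zero.mp (h' ▸ h0)).symm⟩


/-- Every graded two-sided ideal `I` of `A` decomposes as
`I = (I ∩ B) ⊕ x·(I ∩ B)`: every element of `I` can be written uniquely as `b + x·b′` with
`b, b′ ∈ I ∩ B`. Moreover `I ∩ B` is a graded two-sided ideal of the subalgebra `B`. -/
theorem graded_ideal_decomposition
    (k A : Type*) [Field k] [Ring A] [Algebra k A]
    (h2 : (2 : k) ≠ 0)
    (A0 A1 : Submodule k A)
    (hsup : A0 ⊔ A1 = ⊤) (hinf : A0 ⊓ A1 = ⊥)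
    (h00 : ∀ a ∈ A0, ∀ b ∈ A0, a * b ∈ A0)
    (h01 : ∀ a ∈ A0, ∀ b ∈ A1, a * b ∈ A1)
    (h10 : ∀ a ∈ A1, ∀ b ∈ A0, a * b ∈ A1)
    (h11 : ∀ a ∈ A1, ∀ b ∈ A1, a * b ∈ A0)
    (hone : (1 : A) ∈ A0)
    (x : A) (hx1 : x ∈ A1) (hxx : x * x = 1)
    (B : Subalgebra k A)
    (hB : Subalgebra.toSubmodule B =
        (A0 ⊓ LinearMap.ker (LinearMap.mulLeft k x - LinearMap.mulRight k x)) ⊔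
        (A1 ⊓ LinearMap.ker (LinearMap.mulLeft k x + LinearMap.mulRight k x)))
    (I : TwoSidedIdeal A)
    -- `I` is graded: `I = (I ∩ A₀) + (I ∩ A₁)`
    (hI : ∀ a ∈ I, ∃ a0 ∈ I, ∃ a1 ∈ I, a0 ∈ A0 ∧ a1 ∈ A1 ∧ a = a0 + a1) :
    -- unique decomposition `I = (I ∩ B) ⊕ x·(I ∩ B)`
    (∀ a ∈ I, ∃! p : {b : B // (b : A) ∈ I} × {b : B // (b : A) ∈ I},
        a = ((p.1 : B) : A) + x * ((p.2 : B) : A)) ∧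
    -- `I ∩ B` is a graded two-sided ideal of `B`
    (∃ J : TwoSidedIdeal B, (∀ b : B, b ∈ J ↔ (b : A) ∈ I) ∧
      ∀ b ∈ J, ∃ b0 ∈ J, ∃ b1 ∈ J, ((b0 : A) ∈ A0) ∧ ((b1 : A) ∈ A1) ∧ b = b0 + b1) := by
  have memB (b : A) : b ∈ B ↔ ∃ b0 ∈ A0, ∃ b1 ∈ A1,
      x * b0 = b0 * x ∧ x * b1 = -(b1 * x) ∧ b0 + b1 = b := by
    rw [← Subalgebra.mem_toSubmodule, hB, Submodule.mem_sup]
    simp only [Submodule.mem_inf, LinearMap.mem_ker, LinearMap.sub_apply, LinearMap.add_apply,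
      LinearMap.mulLeft_apply, LinearMap.mulRight_apply, sub_eq_zero, add_eq_zero_iff_eq_neg]
    constructor
    · rintro ⟨b0, ⟨h0, e0⟩, b1, ⟨h1, e1⟩, rfl⟩
      exact ⟨b0, h0, b1, h1, e0, e1, rfl⟩
    · rintro ⟨b0, h0, b1, h1, e0, e1, rfl⟩
      exact ⟨b0, ⟨h0, e0⟩, b1, ⟨h1, e1⟩, rfl⟩
  have hl (b : A) : x * (x * b) = b := by rw [← mul_assoc, hxx, one_mul]
  have indep {b c : A} (hb : b ∈ B) (hc : c ∈ B) (h : b + x * c = 0) : b = 0 ∧ c = 0 := by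
    obtain ⟨b0, hb0, b1, hb1, eb0, eb1, rfl⟩ := (memB b).mp hb
    obtain ⟨c0, hc0, c1, hc1, ec0, ec1, rfl⟩ := (memB c).mp hc
    obtain ⟨e0, e1⟩ := Submodule.eq_and_eq_of_add_eq_add hinf
      (A0.add_mem hb0 (h11 x hx1 c1 hc1)) A0.zero_mem
      (A1.add_mem hb1 (h10 x hx1 c0 hc0)) A1.zero_mem (by
        rw [add_zero, ← h, mul_add]; abel)
    obtain ⟨rfl, rfl⟩ := eq_zero_of_commute_add_mul_anticommute h2 hxx eb0 ec1 e0
    obtain ⟨rfl, rfl⟩ := eq_zero_of_anticommute_add_mul_commute h2 hxx eb1 ec0 e1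
    exact ⟨add_zero 0, add_zero 0⟩
  refine ⟨fun a ha => ?_, I.comap B.val, fun b => by rw [TwoSidedIdeal.mem_comap]; rfl, ?_⟩
  · obtain ⟨a0, ha0, a1, ha1, hA0, hA1, rfl⟩ := hI a ha
    obtain ⟨p0, hp0, q0, hq0, dp0, dq0, ep0, eq0, e0⟩ :=
      exists_commute_add_mul_anticommute h2 hxx I ha0
    obtain ⟨p1, hp1, q1, hq1, dp1, dq1, ep1, eq1, e1⟩ :=
      exists_commute_add_mul_anticommute h2 hxx I ha1
    have gp0 : p0 ∈ A0 := dp0 ▸ A0.smul_mem _ (A0.add_mem hA0 (h11 _ (h10 _ hx1 _ hA0) _ hx1))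
    have gq0 : q0 ∈ A1 := dq0 ▸ A1.smul_mem _ (A1.sub_mem (h10 _ hx1 _ hA0) (h01 _ hA0 _ hx1))
    have gp1 : p1 ∈ A1 := dp1 ▸ A1.smul_mem _ (A1.add_mem hA1 (h01 _ (h11 _ hx1 _ hA1) _ hx1))
    have gq1 : q1 ∈ A0 := dq1 ▸ A0.smul_mem _ (A0.sub_mem (h11 _ hx1 _ hA1) (h11 _ hA1 _ hx1))
    have hb : p0 + x * q1 ∈ B := (memB _).mpr ⟨p0, gp0, x * q1, h10 _ hx1 _ gq1, ep0, by
      rw [mul_assoc, ← mul_neg, ← eq1], rfl⟩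
    have hb' : x * p1 + q0 ∈ B := (memB _).mpr ⟨x * p1, h11 _ hx1 _ gp1, q0, gq0, by
      rw [mul_assoc, ← ep1], eq0, rfl⟩
    have hsum : a0 + a1 = p0 + x * q1 + x * (x * p1 + q0) := by
      rw [mul_add, hl]
      nth_rw 1 [e0, e1]
      abel
    refine ⟨(⟨⟨_, hb⟩, I.add_mem hp0 (I.mul_mem_left _ _ hq1)⟩,
      ⟨⟨_, hb'⟩, I.add_mem (I.mul_mem_left _ _ hp1) hq0⟩), hsum, ?_⟩
    rintro ⟨⟨⟨c, hc⟩, _⟩, ⟨⟨c', hc'⟩, _⟩⟩ h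
    obtain ⟨h0, h1⟩ := indep (B.sub_mem hc hb) (B.sub_mem hc' hb') (by
      rw [mul_sub, sub_add_sub_comm, ← hsum, sub_eq_zero]
      exact h.symm)
    simp only [Prod.mk.injEq, Subtype.mk.injEq]
    exact ⟨sub_eq_zero.mp h0, sub_eq_zero.mp h1⟩
  · rintro ⟨b, hb⟩ hbI
    replace hbI : b ∈ I := by rwa [TwoSidedIdeal.mem_comap] at hbI
    obtain ⟨a0, ha0, a1, ha1, hA0, hA1, hab⟩ := hI b hbI
    obtain ⟨b0, hb0, b1, hb1, eb0, eb1, rfl⟩ := (memB b).mp hb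
    obtain ⟨rfl, rfl⟩ := Submodule.eq_and_eq_of_add_eq_add hinf hb0 hA0 hb1 hA1 hab
    have m0 : b0 ∈ B := (memB _).mpr ⟨b0, hb0, 0, A1.zero_mem, eb0, by simp, add_zero _⟩
    have m1 : b1 ∈ B := (memB _).mpr ⟨0, A0.zero_mem, b1, hb1, by simp, eb1, zero_add _⟩
    exact ⟨⟨b0, m0⟩, (TwoSidedIdeal.mem_comap _).mpr ha0, ⟨b1, m1⟩,
      (TwoSidedIdeal.mem_comap _).mpr ha1, hb0, hb1, rfl⟩
end

section
/- The assignments I ↦ I ∩ B and J ↦ J + x·J are mutually inverse bijections between the set of graded two-sided ideals of A and the set of graded two-sided ideals of B. (In particular, for every graded two-sided ideal J of B, the k-subspace J + x·J is a graded two-sided ideal of A.) -/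
/-- In a direct sum of two submodules the components of an element are unique. -/
theorem Submodule.eq_and_eq_of_add_eq_add_s4 {k A : Type*} [Ring k] [AddCommGroup A] [Module k A]
    {P Q : Submodule k A} (h : P ⊓ Q = ⊥) {p p' q q' : A} (hp : p ∈ P) (hp' : p' ∈ P)
    (hq : q ∈ Q) (hq' : q' ∈ Q) (e : p + q = p' + q') : p = p' ∧ q = q' := by
  have e' : p - p' = q' - q := by rw [sub_eq_sub_iff_add_eq_add, e, add_comm]
  have hm : p - p' ∈ P ⊓ Q := ⟨P.sub_mem hp hp', e' ▸ Q.sub_mem hq' hq⟩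
  rw [h, Submodule.mem_bot] at hm
  exact ⟨sub_eq_zero.1 hm, (sub_eq_zero.1 (e' ▸ hm)).symm⟩

/-- If `2` is invertible and `x * x = 1`, every element of a two-sided ideal is the sum of an
element of the ideal commuting with `x` and one anticommuting with `x`. -/
theorem TwoSidedIdeal.exists_commute_add_anticommute {k A : Type*} [Field k] [Ring A] [Algebra k A]
    (h2 : (2 : k) ≠ 0) {x : A} (hxx : x * x = 1) (I : TwoSidedIdeal A) {a : A} (ha : a ∈ I) :
    ∃ p ∈ I, ∃ q ∈ I, x * p = p * x ∧ x * q = -(q * x) ∧ a = p + q ∧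
      p = (2 : k)⁻¹ • (a + x * a * x) ∧ q = (2 : k)⁻¹ • (a - x * a * x) := by
  have hxl (b : A) : x * (x * b) = b := by rw [← mul_assoc, hxx, one_mul]
  have hs (b : A) (hb : b ∈ I) : (2 : k)⁻¹ • b ∈ I := by
    rw [Algebra.smul_def]
    exact I.mul_mem_left _ _ hb
  have hxax : x * a * x ∈ I := I.mul_mem_right _ _ (I.mul_mem_left _ _ ha)
  refine ⟨_, hs _ (I.add_mem ha hxax), _, hs _ (I.sub_mem ha hxax), ?_, ?_, ?_, rfl, rfl⟩
  · rw [mul_smul_comm, smul_mul_assoc]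
    simp only [mul_add, add_mul, mul_assoc, hxl, hxx, mul_one, add_comm]
  · rw [mul_smul_comm, smul_mul_assoc, ← smul_neg]
    simp only [mul_sub, sub_mul, mul_assoc, hxl, hxx, mul_one, neg_sub]
  · rw [← smul_add, add_add_sub_cancel, ← two_smul k a, smul_smul, inv_mul_cancel₀ h2, one_smul]

/-- If `2` is invertible and `x` is a unit, only zero both commutes and anticommutes with `x`. -/
theorem eq_zero_of_commute_of_anticommute {k A : Type*} [Field k] [Ring A] [Algebra k A]
    (h2 : (2 : k) ≠ 0) {x : A} (hxx : x * x = 1) {a : A} (hc : x * a = a * x)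
    (hac : x * a = -(a * x)) : a = 0 := by
  have h : (2 : k) • (x * a) = 0 := by
    rw [two_smul]
    nth_rw 2 [hac]
    rw [hc, add_neg_cancel]
  have h' : x * a = 0 := (smul_eq_zero.1 h).resolve_left h2
  rw [← one_mul a, ← hxx, mul_assoc, h', mul_zero]


/-- The assignments `I ↦ I ∩ B` and `J ↦ J + x·J` are mutually inverse bijections
between the set of graded two-sided ideals of `A` and the set of graded two-sided ideals of the
supercentralizer `B`.  (In particular, for every graded two-sided ideal `J` of `B`, the subspace
`J + x·J` is a graded two-sided ideal of `A`.) -/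
theorem graded_ideal_bijection
    (k A : Type*) [Field k] [Ring A] [Algebra k A]
    (h2 : (2 : k) ≠ 0)
    (A0 A1 : Submodule k A)
    (hsup : A0 ⊔ A1 = ⊤) (hinf : A0 ⊓ A1 = ⊥)
    (h00 : ∀ a ∈ A0, ∀ b ∈ A0, a * b ∈ A0)
    (h01 : ∀ a ∈ A0, ∀ b ∈ A1, a * b ∈ A1)
    (h10 : ∀ a ∈ A1, ∀ b ∈ A0, a * b ∈ A1)
    (h11 : ∀ a ∈ A1, ∀ b ∈ A1, a * b ∈ A0)
    (hone : (1 : A) ∈ A0)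
    (x : A) (hx1 : x ∈ A1) (hxx : x * x = 1)
    (B : Subalgebra k A)
    (hB : Subalgebra.toSubmodule B =
        (A0 ⊓ LinearMap.ker (LinearMap.mulLeft k x - LinearMap.mulRight k x)) ⊔
        (A1 ⊓ LinearMap.ker (LinearMap.mulLeft k x + LinearMap.mulRight k x)))
    -- the gradedness conditions on two-sided ideals of `A` and of `B`
    (gradedA : TwoSidedIdeal A → Prop)
    (hgradedA : ∀ I, gradedA I ↔
      ∀ a ∈ I, ∃ a0 ∈ I, ∃ a1 ∈ I, a0 ∈ A0 ∧ a1 ∈ A1 ∧ a = a0 + a1)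
    (gradedB : TwoSidedIdeal B → Prop)
    (hgradedB : ∀ J, gradedB J ↔
      ∀ b ∈ J, ∃ b0 ∈ J, ∃ b1 ∈ J, ((b0 : A) ∈ A0) ∧ ((b1 : A) ∈ A1) ∧ b = b0 + b1) :
    -- `I ↦ I ∩ B` sends graded ideals of `A` to graded ideals of `B`
    (∀ I : TwoSidedIdeal A, gradedA I →
      ∃ J : TwoSidedIdeal B, gradedB J ∧ (J : Set B) = {b : B | (b : A) ∈ I}) ∧
    -- `J ↦ J + x·J` sends graded ideals of `B` to graded ideals of `A`
    (∀ J : TwoSidedIdeal B, gradedB J →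
      ∃ I : TwoSidedIdeal A, gradedA I ∧
        (I : Set A) = {a : A | ∃ b ∈ J, ∃ b' ∈ J, a = (b : A) + x * (b' : A)}) ∧
    -- round trip on graded ideals of `A`:  `(I ∩ B) + x·(I ∩ B) = I`
    (∀ I : TwoSidedIdeal A, gradedA I →
      (I : Set A) = {a : A | ∃ b : B, (b : A) ∈ I ∧ ∃ b' : B, (b' : A) ∈ I ∧
        a = (b : A) + x * (b' : A)}) ∧
    -- round trip on graded ideals of `B`:  `(J + x·J) ∩ B = J`
    (∀ J : TwoSidedIdeal B, gradedB J →
      ∀ b : B, b ∈ J ↔ ∃ c ∈ J, ∃ c' ∈ J, (b : A) = (c : A) + x * (c' : A)) := by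
  have hxl (b : A) : x * (x * b) = b := by rw [← mul_assoc, hxx, one_mul]
  have hsplit (a : A) : ∃ p ∈ A0, ∃ q ∈ A1, p + q = a :=
    Submodule.mem_sup.1 (hsup ▸ Submodule.mem_top)
  have hBmem (a : A) : a ∈ B ↔ ∃ p ∈ A0, x * p = p * x ∧
      ∃ q ∈ A1, x * q = -(q * x) ∧ p + q = a := by
    rw [← Subalgebra.mem_toSubmodule, hB, Submodule.mem_sup]
    simp only [Submodule.mem_inf, LinearMap.mem_ker, LinearMap.sub_apply, LinearMap.add_apply,
      LinearMap.mulLeft_apply, LinearMap.mulRight_apply, sub_eq_zero, add_eq_zero_iff_eq_neg,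
      and_assoc]
  have hB0 (p : A) (hp : p ∈ A0) (hc : x * p = p * x) : p ∈ B :=
    (hBmem p).2 ⟨p, hp, hc, 0, A1.zero_mem, by simp, add_zero p⟩
  have hB1 (q : A) (hq : q ∈ A1) (hc : x * q = -(q * x)) : q ∈ B :=
    (hBmem q).2 ⟨0, A0.zero_mem, by simp, q, hq, hc, zero_add q⟩
  have hcomm (b : B) (hb : (b : A) ∈ A0) : x * (b : A) = b * x := by
    obtain ⟨p, hp, hpx, q, hq, -, e⟩ := (hBmem b).1 b.2
    rw [← (Submodule.eq_and_eq_of_add_eq_add_s4 hinf hp hb hq A1.zero_mem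
      (e.trans (add_zero _).symm)).1, hpx]
  have hanti (b : B) (hb : (b : A) ∈ A1) : x * (b : A) = -(b * x) := by
    obtain ⟨p, hp, -, q, hq, hqx, e⟩ := (hBmem b).1 b.2
    rw [← (Submodule.eq_and_eq_of_add_eq_add_s4 hinf hp A0.zero_mem hq hb
      (e.trans (zero_add _).symm)).2, hqx]
  have hBsplit (b : B) : ∃ b0 b1 : B, (b0 : A) ∈ A0 ∧ (b1 : A) ∈ A1 ∧ b = b0 + b1 := by
    obtain ⟨p, hp, hpx, q, hq, hqx, e⟩ := (hBmem b).1 b.2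
    exact ⟨⟨p, hB0 p hp hpx⟩, ⟨q, hB1 q hq hqx⟩, hp, hq, Subtype.ext e.symm⟩
  have hswap (b0 b1 : B) (hb0 : (b0 : A) ∈ A0) (hb1 : (b1 : A) ∈ A1) :
      ((b0 + b1 : B) : A) * x = x * ((b0 - b1 : B) : A) := by
    simp only [Subalgebra.coe_add, Subalgebra.coe_sub, mul_sub, hcomm b0 hb0, hanti b1 hb1,
      add_mul, sub_neg_eq_add]
  have hBswap (b : B) : ∃ s : B, (b : A) * x = x * (s : A) := by
    obtain ⟨b0, b1, hb0, hb1, rfl⟩ := hBsplit b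
    exact ⟨_, hswap b0 b1 hb0 hb1⟩
  have hJswap (J : TwoSidedIdeal B) (hJ : gradedB J) (b : B) (hb : b ∈ J) :
      ∃ s ∈ J, (b : A) * x = x * (s : A) := by
    obtain ⟨b0, h0, b1, h1, hb0, hb1, rfl⟩ := (hgradedB J).1 hJ b hb
    exact ⟨_, J.sub_mem h0 h1, hswap b0 b1 hb0 hb1⟩
  have hdec0 (I : TwoSidedIdeal A) (a : A) (haI : a ∈ I) (ha : a ∈ A0) :
      ∃ b b' : B, (b : A) ∈ I ∧ (b' : A) ∈ I ∧ a = b + x * b' := by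
    obtain ⟨p, hpI, q, hqI, hp, hq, e, hpe, hqe⟩ :=
      I.exists_commute_add_anticommute h2 hxx haI
    have hxax : x * a * x ∈ A0 := h11 _ (h10 _ hx1 _ ha) _ hx1
    refine ⟨⟨p, hB0 p (hpe ▸ A0.smul_mem _ (A0.add_mem ha hxax)) hp⟩,
      ⟨x * q, hB1 _ (h10 _ hx1 _ (hqe ▸ A0.smul_mem _ (A0.sub_mem ha hxax))) ?_⟩,
      hpI, I.mul_mem_left _ _ hqI, e.trans (by rw [hxl])⟩
    rw [hq, neg_mul, neg_neg, mul_neg, mul_assoc, hxx, mul_one, ← neg_eq_iff_eq_neg.2 hq,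
      mul_neg, hxl, neg_neg]
  have hdec1 (I : TwoSidedIdeal A) (a : A) (haI : a ∈ I) (ha : a ∈ A1) :
      ∃ b b' : B, (b : A) ∈ I ∧ (b' : A) ∈ I ∧ a = b + x * b' := by
    obtain ⟨p, hpI, q, hqI, hp, hq, e, hpe, hqe⟩ :=
      I.exists_commute_add_anticommute h2 hxx haI
    have hxax : x * a * x ∈ A1 := h01 _ (h11 _ hx1 _ ha) _ hx1
    refine ⟨⟨q, hB1 q (hqe ▸ A1.smul_mem _ (A1.sub_mem ha hxax)) hq⟩,
      ⟨x * p, hB0 _ (h11 _ hx1 _ (hpe ▸ A1.smul_mem _ (A1.add_mem ha hxax))) ?_⟩,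
      hqI, I.mul_mem_left _ _ hpI, e.trans (by rw [hxl, add_comm])⟩
    rw [mul_assoc, hp]
  have hdec (I : TwoSidedIdeal A) (hI : ∀ a ∈ I, ∃ a0 ∈ I, ∃ a1 ∈ I, a0 ∈ A0 ∧ a1 ∈ A1 ∧
      a = a0 + a1) (a : A) (haI : a ∈ I) :
      ∃ b b' : B, (b : A) ∈ I ∧ (b' : A) ∈ I ∧ a = b + x * b' := by
    obtain ⟨a0, h0, a1, h1, ha0, ha1, rfl⟩ := hI a haI
    obtain ⟨b, b', hb, hb', rfl⟩ := hdec0 I a0 h0 ha0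
    obtain ⟨c, c', hc, hc', rfl⟩ := hdec1 I a1 h1 ha1
    refine ⟨b + c, b' + c', I.add_mem hb hc, I.add_mem hb' hc', ?_⟩
    simp only [Subalgebra.coe_add, mul_add]
    abel
  have hAdec (a : A) : ∃ b b' : B, a = b + x * b' := by
    obtain ⟨b, b', -, -, e⟩ := hdec ⊤ (fun a _ => by
      obtain ⟨p, hp, q, hq, e⟩ := hsplit a
      exact ⟨p, trivial, q, trivial, hp, hq, e.symm⟩) a trivial
    exact ⟨b, b', e⟩
  have hdisj (d c : B) (e : (d : A) = x * c) : (d : A) = 0 := by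
    obtain ⟨d0, d1, hd0, hd1, rfl⟩ := hBsplit d
    obtain ⟨c0, c1, hc0, hc1, rfl⟩ := hBsplit c
    rw [Subalgebra.coe_add, Subalgebra.coe_add, mul_add, add_comm (x * (c0 : A))] at e
    obtain ⟨e0, e1⟩ := Submodule.eq_and_eq_of_add_eq_add_s4 hinf hd0 (h11 _ hx1 _ hc1) hd1
      (h10 _ hx1 _ hc0) e
    have z0 : (d0 : A) = 0 := eq_zero_of_commute_of_anticommute h2 hxx (hcomm d0 hd0) (by
      rw [e0, hxl, mul_assoc, ← mul_neg, ← hanti c1 hc1, hxl])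
    have z1 : (d1 : A) = 0 := eq_zero_of_commute_of_anticommute h2 hxx (by
      rw [e1, hxl, mul_assoc, ← hcomm c0 hc0, hxl]) (hanti d1 hd1)
    rw [Subalgebra.coe_add, z0, z1, add_zero]
  refine ⟨fun I hI => ?_, fun J hJ => ?_, fun I hI => ?_, fun J hJ b => ⟨fun hb => ?_, ?_⟩⟩
  · refine ⟨I.comap B.val, (hgradedB _).2 fun b hb => ?_, ?_⟩
    · obtain ⟨a0, h0, a1, h1, ha0, ha1, e⟩ := (hgradedA I).1 hI b
        ((TwoSidedIdeal.mem_comap _).1 hb)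
      obtain ⟨b0, b1, hb0, hb1, rfl⟩ := hBsplit b
      obtain ⟨rfl, rfl⟩ := Submodule.eq_and_eq_of_add_eq_add_s4 hinf hb0 ha0 hb1 ha1 e
      exact ⟨b0, (TwoSidedIdeal.mem_comap _).2 h0, b1, (TwoSidedIdeal.mem_comap _).2 h1,
        hb0, hb1, rfl⟩
    · ext b
      exact TwoSidedIdeal.mem_comap _
  · let S : Set A := {a : A | ∃ b ∈ J, ∃ b' ∈ J, a = (b : A) + x * (b' : A)}
    have hadd {a a' : A} : a ∈ S → a' ∈ S → a + a' ∈ S := by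
      rintro ⟨b, hb, b', hb', rfl⟩ ⟨c, hc, c', hc', rfl⟩
      refine ⟨b + c, J.add_mem hb hc, b' + c', J.add_mem hb' hc', ?_⟩
      simp only [Subalgebra.coe_add, mul_add]
      abel
    have hneg {a : A} : a ∈ S → -a ∈ S := by
      rintro ⟨b, hb, b', hb', rfl⟩
      refine ⟨-b, J.neg_mem hb, -b', J.neg_mem hb', ?_⟩
      simp only [Subalgebra.coe_neg, mul_neg, neg_add]
    have hmul_left {a s : A} : s ∈ S → a * s ∈ S := by
      rintro ⟨j, hj, j', hj', rfl⟩
      obtain ⟨b, b', rfl⟩ := hAdec a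
      obtain ⟨c, hc⟩ := hBswap b
      obtain ⟨c', hc'⟩ := hBswap b'
      refine ⟨b * j + c' * j', J.add_mem (J.mul_mem_left _ _ hj) (J.mul_mem_left _ _ hj'),
        c * j' + b' * j, J.add_mem (J.mul_mem_left _ _ hj') (J.mul_mem_left _ _ hj), ?_⟩
      have e1 : (b : A) * (x * j') = x * (c * j') := by rw [← mul_assoc, hc, mul_assoc]
      have e2 : x * (b' : A) * (x * j') = c' * j' := by
        rw [mul_assoc, ← mul_assoc (b' : A), hc', mul_assoc, hxl]
      simp only [Subalgebra.coe_add, Subalgebra.coe_mul, mul_add, add_mul, e1, e2]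
      rw [mul_assoc x (b' : A) (j : A)]
      abel
    have hmul_right {s a : A} : s ∈ S → s * a ∈ S := by
      rintro ⟨j, hj, j', hj', rfl⟩
      obtain ⟨b, b', rfl⟩ := hAdec a
      obtain ⟨c, hcJ, hc⟩ := hJswap J hJ j hj
      obtain ⟨c', hcJ', hc'⟩ := hJswap J hJ j' hj'
      refine ⟨j * b + c' * b', J.add_mem (J.mul_mem_right _ _ hj) (J.mul_mem_right _ _ hcJ'),
        c * b' + j' * b, J.add_mem (J.mul_mem_right _ _ hcJ) (J.mul_mem_right _ _ hj'), ?_⟩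
      have e1 : (j : A) * (x * b') = x * (c * b') := by rw [← mul_assoc, hc, mul_assoc]
      have e2 : x * (j' : A) * (x * b') = c' * b' := by
        rw [mul_assoc, ← mul_assoc (j' : A), hc', mul_assoc, hxl]
      simp only [Subalgebra.coe_add, Subalgebra.coe_mul, mul_add, add_mul, e1, e2]
      rw [mul_assoc x (j' : A) (b : A)]
      abel
    have hzero : (0 : A) ∈ S := ⟨0, J.zero_mem, 0, J.zero_mem, by simp⟩
    have hS : (TwoSidedIdeal.mk' S hzero hadd hneg hmul_left hmul_right : Set A) = S :=
      TwoSidedIdeal.coe_mk' ..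
    refine ⟨_, (hgradedA _).2 fun a ha => ?_, hS⟩
    simp only [← SetLike.mem_coe, hS] at ha ⊢
    obtain ⟨b, hb, b', hb', rfl⟩ := ha
    obtain ⟨b0, h0, b1, h1, hb0, hb1, rfl⟩ := (hgradedB J).1 hJ b hb
    obtain ⟨c0, h0', c1, h1', hc0, hc1, rfl⟩ := (hgradedB J).1 hJ b' hb'
    refine ⟨_, ⟨b0, h0, c1, h1', rfl⟩, _, ⟨b1, h1, c0, h0', rfl⟩,
      A0.add_mem hb0 (h11 _ hx1 _ hc1), A1.add_mem hb1 (h10 _ hx1 _ hc0), ?_⟩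
    simp only [Subalgebra.coe_add, mul_add]
    abel
  · ext a
    constructor
    · intro ha
      obtain ⟨b, b', hb, hb', e⟩ := hdec I ((hgradedA I).1 hI) a ha
      exact ⟨b, hb, b', hb', e⟩
    · rintro ⟨b, hb, b', hb', rfl⟩
      exact I.add_mem hb (I.mul_mem_left _ _ hb')
  · exact ⟨b, hb, 0, J.zero_mem, by simp⟩
  · rintro ⟨c, hc, c', -, e⟩
    have h := hdisj (b - c) c' (by rw [Subalgebra.coe_sub, e, add_sub_cancel_left])
    rw [Subalgebra.coe_sub, sub_eq_zero] at h
    exact Subtype.ext h ▸ hc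
end
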